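/- arXiv:2401.04289 — 4 statements merged into one kernel-verified Lean document; each statement's English description precedes it below -/
import Mathlib

section
/- Let c > 0, let x₀ > 0, y₀ > 0, and let b ≥ 0. Let S = {(x,y) ∈ ℝ² : x > 0, y > 0, x^c · y − x₀^c · y₀ ≥ b}. Then S is strictly convex: for all distinct points p, q ∈ S and every t ∈ (0,1), the point t·p + (1−t)·q lies in the interior of S (in ℝ²). In particular, writing p = (x₁,y₁) and q = (x₂,y₂), one has (t·x₁ + (1−t)·x₂)^c · (t·y₁ + (1−t)·y₂) − x₀^c·y₀ > b. -/
/-- For `c > 0`, the function `(x, y) ↦ c * log x + log y` is strictly concave on the open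
positive quadrant. -/
theorem strictConcaveOn_mul_log_add_log {c : ℝ} (hc : 0 < c) :
    StrictConcaveOn ℝ (Set.Ioi (0 : ℝ) ×ˢ Set.Ioi (0 : ℝ))
      fun r : ℝ × ℝ => c * Real.log r.1 + Real.log r.2 := by
  refine ⟨(convex_Ioi 0).prod (convex_Ioi 0), ?_⟩
  rintro ⟨x₁, y₁⟩ ⟨hx₁, hy₁⟩ ⟨x₂, y₂⟩ ⟨hx₂, hy₂⟩ hne s t hs ht hst
  have hx := strictConcaveOn_log_Ioi.concaveOn.2 hx₁ hx₂ hs.le ht.le hst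
  have hy := strictConcaveOn_log_Ioi.concaveOn.2 hy₁ hy₂ hs.le ht.le hst
  simp only [smul_eq_mul, Prod.smul_mk, Prod.mk_add_mk] at hx hy ⊢
  by_cases h : x₁ = x₂
  · have hy' := strictConcaveOn_log_Ioi.2 hy₁ hy₂ (fun e => hne (Prod.ext h e)) hs ht hst
    simp only [smul_eq_mul] at hy'
    linarith [mul_le_mul_of_nonneg_left hx hc.le]
  · have hx' := strictConcaveOn_log_Ioi.2 hx₁ hx₂ h hs ht hst
    simp only [smul_eq_mul] at hx'
    linarith [mul_lt_mul_of_pos_left hx' hc]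

theorem Real.log_rpow_mul {x y : ℝ} (c : ℝ) (hx : 0 < x) (hy : 0 < y) :
    Real.log (x ^ c * y) = c * Real.log x + Real.log y := by
  rw [Real.log_mul (Real.rpow_pos_of_pos hx c).ne' hy.ne', Real.log_rpow hx]

/-- For `c > 0`, the function `(x, y) ↦ x ^ c * y` is strictly quasiconcave on the open
positive quadrant. -/
theorem lt_rpow_mul_of_convex_combination {c k : ℝ} (hc : 0 < c) (hk : 0 < k) {p q : ℝ × ℝ}
    (hp₁ : 0 < p.1) (hp₂ : 0 < p.2) (hq₁ : 0 < q.1) (hq₂ : 0 < q.2)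
    (hp : k ≤ p.1 ^ c * p.2) (hq : k ≤ q.1 ^ c * q.2) (hne : p ≠ q)
    {s t : ℝ} (hs : 0 < s) (ht : 0 < t) (hst : s + t = 1) :
    k < (s * p.1 + t * q.1) ^ c * (s * p.2 + t * q.2) := by
  have hx : 0 < s * p.1 + t * q.1 := by positivity
  have hy : 0 < s * p.2 + t * q.2 := by positivity
  have h := (strictConcaveOn_mul_log_add_log hc).2 (x := p) ⟨hp₁, hp₂⟩ (y := q) ⟨hq₁, hq₂⟩
    hne hs ht hst
  have hlp := Real.log_le_log hk hp
  have hlq := Real.log_le_log hk hq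
  rw [Real.log_rpow_mul c hp₁ hp₂] at hlp
  rw [Real.log_rpow_mul c hq₁ hq₂] at hlq
  rw [← Real.log_lt_log_iff hk (mul_pos (Real.rpow_pos_of_pos hx c) hy),
    Real.log_rpow_mul c hx hy]
  simp only [smul_eq_mul, Prod.fst_add, Prod.snd_add, Prod.smul_fst, Prod.smul_snd] at h
  calc Real.log k = s * Real.log k + t * Real.log k := by rw [← add_mul, hst, one_mul]
    _ ≤ _ := add_le_add (mul_le_mul_of_nonneg_left hlp hs.le)
      (mul_le_mul_of_nonneg_left hlq ht.le)
    _ < _ := h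

/-- For `c > 0`, `(x₀, y₀) ∈ ℝ_{>0}²` and `b ≥ 0`, the superlevel set
`S = {(x,y) : x > 0, y > 0, x^c * y - x₀^c * y₀ ≥ b}` is strictly convex:
any proper convex combination of two distinct points of `S` lies in the
interior of `S`; moreover the value of `A` at such a combination strictly
exceeds `b`. -/
theorem amm_superlevel_strictly_convex (c x₀ y₀ b : ℝ)
    (hc : 0 < c) (hx₀ : 0 < x₀) (hy₀ : 0 < y₀) (hb : 0 ≤ b) :
    ∀ p q : ℝ × ℝ,
      p ∈ {r : ℝ × ℝ | 0 < r.1 ∧ 0 < r.2 ∧ b ≤ r.1 ^ c * r.2 - x₀ ^ c * y₀} →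
      q ∈ {r : ℝ × ℝ | 0 < r.1 ∧ 0 < r.2 ∧ b ≤ r.1 ^ c * r.2 - x₀ ^ c * y₀} →
      p ≠ q → ∀ t : ℝ, 0 < t → t < 1 →
        t • p + (1 - t) • q ∈
          interior {r : ℝ × ℝ | 0 < r.1 ∧ 0 < r.2 ∧ b ≤ r.1 ^ c * r.2 - x₀ ^ c * y₀} ∧
        b < (t * p.1 + (1 - t) * q.1) ^ c * (t * p.2 + (1 - t) * q.2) - x₀ ^ c * y₀ := by
  rintro p q ⟨hp₁, hp₂, hp⟩ ⟨hq₁, hq₂, hq⟩ hne t ht ht'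
  have hs : 0 < 1 - t := sub_pos.2 ht'
  have hk : 0 < b + x₀ ^ c * y₀ := by positivity
  have hlt : b < (t * p.1 + (1 - t) * q.1) ^ c * (t * p.2 + (1 - t) * q.2) - x₀ ^ c * y₀ :=
    lt_sub_iff_add_lt.2 <| lt_rpow_mul_of_convex_combination hc hk hp₁ hp₂ hq₁ hq₂
      (le_sub_iff_add_le.1 hp) (le_sub_iff_add_le.1 hq) hne ht hs (add_sub_cancel t 1)
  refine ⟨?_, hlt⟩
  have hcont : Continuous fun r : ℝ × ℝ => r.1 ^ c * r.2 - x₀ ^ c * y₀ :=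
    ((continuous_fst.rpow_const fun _ => Or.inr hc.le).mul continuous_snd).sub continuous_const
  have hopen : IsOpen {r : ℝ × ℝ | 0 < r.1 ∧ 0 < r.2 ∧ b < r.1 ^ c * r.2 - x₀ ^ c * y₀} :=
    (isOpen_lt continuous_const continuous_fst).inter
      ((isOpen_lt continuous_const continuous_snd).inter (isOpen_lt continuous_const hcont))
  refine mem_interior.2 ⟨_, fun r hr => ⟨hr.1, hr.2.1, hr.2.2.le⟩, hopen, ?_, ?_, hlt⟩
  · change 0 < t * p.1 + (1 - t) * q.1
    positivity
  · change 0 < t * p.2 + (1 - t) * q.2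
    positivity
end

section
/- Let c > 0, x₀ > 0, y₀ > 0. Then there exists a function A defined on {(x,y) ∈ ℝ² : x > 0, y > 0} with values in ℝ such that: (i) A is twice continuously differentiable (C²) on this open set; (ii) A is strictly increasing in each coordinate (if x' > x then A(x',y) > A(x,y) for every y > 0, and if y' > y then A(x,y') > A(x,y) for every x > 0); (iii) for every b ≥ 0, the set {(x,y) : x > 0, y > 0, A(x,y) ≥ b} is closed in the subspace topology of ℝ_{>0}² and strictly convex (every point t·p + (1−t)·q with p ≠ q in the set and t ∈ (0,1) lies in its interior); and (iv) {(x,y) : x > 0, y > 0, A(x,y) = 0} = {(x, y₀·(x/x₀)^{−c}) : x > 0}. (Namely, A(x,y) = x^c·y − x₀^c·y₀ works.) -/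
/-- The logarithm of the trading function `x ^ c * y`, shifted by a constant. -/
noncomputable def logTradingFunction (c k : ℝ) (p : ℝ × ℝ) : ℝ :=
  c * Real.log p.1 + Real.log p.2 - k

theorem contDiffOn_logTradingFunction (c k : ℝ) {n : WithTop ℕ∞} :
    ContDiffOn ℝ n (logTradingFunction c k) {p : ℝ × ℝ | 0 < p.1 ∧ 0 < p.2} := by
  unfold logTradingFunction
  exact ((contDiffOn_const.mul (contDiff_fst.contDiffOn.log fun p hp => hp.1.ne')).add
    (contDiff_snd.contDiffOn.log fun p hp => hp.2.ne')).sub contDiffOn_const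

theorem isOpen_posQuadrant : IsOpen {p : ℝ × ℝ | 0 < p.1 ∧ 0 < p.2} :=
  (isOpen_lt continuous_const continuous_fst).inter (isOpen_lt continuous_const continuous_snd)

theorem strictConcaveOn_logTradingFunction {c : ℝ} (hc : 0 < c) (k : ℝ) :
    StrictConcaveOn ℝ {p : ℝ × ℝ | 0 < p.1 ∧ 0 < p.2} (logTradingFunction c k) := by
  have log_concave := strictConcaveOn_log_Ioi.concaveOn
  refine ⟨(convex_Ioi (0 : ℝ)).prod (convex_Ioi (0 : ℝ)), ?_⟩
  rintro ⟨x, y⟩ ⟨hx, hy⟩ ⟨x', y'⟩ ⟨hx', hy'⟩ hne a b ha hb hab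
  have h₁ := log_concave.2 (Set.mem_Ioi.2 hx) (Set.mem_Ioi.2 hx') ha.le hb.le hab
  have h₂ := log_concave.2 (Set.mem_Ioi.2 hy) (Set.mem_Ioi.2 hy') ha.le hb.le hab
  simp only [logTradingFunction, smul_eq_mul, Prod.smul_mk, Prod.mk_add_mk] at h₁ h₂ ⊢
  have hk : a * k + b * k = k := by rw [← add_mul, hab, one_mul]
  rcases eq_or_ne x x' with rfl | hxx
  · have hyy : y ≠ y' := fun h => hne (by rw [h])
    have h := strictConcaveOn_log_Ioi.2 (Set.mem_Ioi.2 hy) (Set.mem_Ioi.2 hy') hyy ha hb hab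
    simp only [smul_eq_mul] at h
    linarith [mul_le_mul_of_nonneg_left h₁ hc.le]
  · have h := strictConcaveOn_log_Ioi.2 (Set.mem_Ioi.2 hx) (Set.mem_Ioi.2 hx') hxx ha hb hab
    simp only [smul_eq_mul] at h
    linarith [mul_lt_mul_of_pos_left h hc]

theorem logTradingFunction_eq_zero_iff {c x₀ y₀ x y : ℝ} (hx₀ : 0 < x₀) (hy₀ : 0 < y₀)
    (hx : 0 < x) (hy : 0 < y) :
    logTradingFunction c (c * Real.log x₀ + Real.log y₀) (x, y) = 0 ↔
      y = y₀ * (x / x₀) ^ (-c) := by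
  have hpow : 0 < (x / x₀) ^ (-c) := Real.rpow_pos_of_pos (div_pos hx hx₀) _
  rw [← Real.log_injOn_pos.eq_iff hy (mul_pos hy₀ hpow), Real.log_mul hy₀.ne' hpow.ne',
    Real.log_rpow (div_pos hx hx₀), Real.log_div hx.ne' hx₀.ne', logTradingFunction]
  constructor <;> intro h <;> linarith


/-- The state curve `f_{c,(x₀,y₀)}(x) = y₀ * (x/x₀)^(-c)` induces an AMM: there
exists `A : ℝ × ℝ → ℝ` which is C² on `ℝ_{>0}²`, strictly increasing in each
coordinate there, whose superlevel sets `{A ≥ b}` (for `b ≥ 0`) are closed in the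
subspace topology of `ℝ_{>0}²` and strictly convex, and whose zero set on
`ℝ_{>0}²` is exactly the graph of the state curve. -/
theorem state_curve_induces_AMM (c x₀ y₀ : ℝ)
    (hc : 0 < c) (hx₀ : 0 < x₀) (hy₀ : 0 < y₀) :
    ∃ A : ℝ × ℝ → ℝ,
      -- (i) A is C² on ℝ_{>0}²
      ContDiffOn ℝ 2 A {p : ℝ × ℝ | 0 < p.1 ∧ 0 < p.2} ∧
      -- (ii) strictly increasing in each coordinate
      (∀ x x' y : ℝ, 0 < x → x < x' → 0 < y → A (x, y) < A (x', y)) ∧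
      (∀ x y y' : ℝ, 0 < x → 0 < y → y < y' → A (x, y) < A (x, y')) ∧
      -- (iii) superlevel sets are closed (in the subspace topology) and strictly convex
      (∀ b : ℝ, 0 ≤ b →
        (∃ C : Set (ℝ × ℝ), IsClosed C ∧
          {p : ℝ × ℝ | 0 < p.1 ∧ 0 < p.2 ∧ b ≤ A p} =
            {p : ℝ × ℝ | 0 < p.1 ∧ 0 < p.2} ∩ C) ∧
        (∀ p q : ℝ × ℝ,
          p ∈ {r : ℝ × ℝ | 0 < r.1 ∧ 0 < r.2 ∧ b ≤ A r} →
          q ∈ {r : ℝ × ℝ | 0 < r.1 ∧ 0 < r.2 ∧ b ≤ A r} →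
          p ≠ q → ∀ t : ℝ, 0 < t → t < 1 →
            t • p + (1 - t) • q ∈
              interior {r : ℝ × ℝ | 0 < r.1 ∧ 0 < r.2 ∧ b ≤ A r})) ∧
      -- (iv) the zero set is the graph of the state curve
      {p : ℝ × ℝ | 0 < p.1 ∧ 0 < p.2 ∧ A p = 0} =
        {p : ℝ × ℝ | ∃ x : ℝ, 0 < x ∧ p = (x, y₀ * (x / x₀) ^ (-c))} := by
  set k := c * Real.log x₀ + Real.log y₀
  have hcont : ContinuousOn (logTradingFunction c k) {p : ℝ × ℝ | 0 < p.1 ∧ 0 < p.2} :=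
    (contDiffOn_logTradingFunction c k (n := 0)).continuousOn
  refine ⟨logTradingFunction c k, contDiffOn_logTradingFunction c k, ?_, ?_,
    fun b _ => ⟨?_, ?_⟩, ?_⟩
  · intro x x' y hx hxx' _
    have := mul_lt_mul_of_pos_left (Real.log_lt_log hx hxx') hc
    simp only [logTradingFunction]
    linarith
  · intro x y y' _ hy hyy'
    have := Real.log_lt_log hy hyy'
    simp only [logTradingFunction]
    linarith
  · obtain ⟨C, hC, hCeq⟩ := continuousOn_iff_isClosed.1 hcont (Set.Ici b) isClosed_Ici
    refine ⟨C, hC, ?_⟩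
    rw [Set.inter_comm, ← hCeq]
    ext p
    simp only [Set.mem_ofPred_eq, Set.mem_inter_iff, Set.mem_preimage, Set.mem_Ici]
    tauto
  · rintro p q ⟨hp₁, hp₂, hp⟩ ⟨hq₁, hq₂, hq⟩ hne t ht₀ ht₁
    have hconc := strictConcaveOn_logTradingFunction hc k
    have ht : t + (1 - t) = 1 := by ring
    refine mem_interior.2 ⟨_, ?_, hcont.isOpen_inter_preimage isOpen_posQuadrant isOpen_Ioi,
      hconc.1 ⟨hp₁, hp₂⟩ ⟨hq₁, hq₂⟩ ht₀.le (sub_pos.2 ht₁).le ht, Set.mem_Ioi.2 (?_ : b < _)⟩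
    · rintro r ⟨⟨hr₁, hr₂⟩, hr⟩
      exact ⟨hr₁, hr₂, (Set.mem_Ioi.1 hr).le⟩
    · have h := hconc.2 ⟨hp₁, hp₂⟩ ⟨hq₁, hq₂⟩ hne ht₀ (sub_pos.2 ht₁) ht
      simp only [smul_eq_mul] at h
      linarith [mul_le_mul_of_nonneg_left hp ht₀.le,
        mul_le_mul_of_nonneg_left hq (sub_pos.2 ht₁).le]
  · ext ⟨x, y⟩
    constructor
    · rintro ⟨hx, hy, h⟩
      exact ⟨x, hx, by rw [← (logTradingFunction_eq_zero_iff hx₀ hy₀ hx hy).1 h]⟩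
    · rintro ⟨x', hx', h⟩
      obtain ⟨rfl, rfl⟩ := Prod.mk.inj h
      have hy : 0 < y₀ * (x / x₀) ^ (-c) :=
        mul_pos hy₀ (Real.rpow_pos_of_pos (div_pos hx' hx₀) _)
      exact ⟨hx', hy, (logTradingFunction_eq_zero_iff hx₀ hy₀ hx' hy).2 rfl⟩
end

section
/- Let c₁ > c₂ > 0 and let x₀ > 0, y₀ > 0. Write f₁(x) = y₀·(x/x₀)^{−c₁} and f₂(x) = y₀·(x/x₀)^{−c₂} for x > 0. Then |f₁'(x₀)| > |f₂'(x₀)| and f₁''(x₀) > f₂''(x₀), where f' and f'' denote the first and second derivatives. (Equivalently, c₁·y₀/x₀ > c₂·y₀/x₀ and c₁·(c₁+1)·y₀/x₀² > c₂·(c₂+1)·y₀/x₀², these being the respective values of |fᵢ'(x₀)| and fᵢ''(x₀).) -/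
/-- The derivative of a scaled power curve is again a scaled power curve. -/
theorem hasDerivAt_const_mul_div_rpow (a p : ℝ) {x x₀ : ℝ} (hx : x ≠ 0) (hx₀ : x₀ ≠ 0) :
    HasDerivAt (fun x : ℝ => a * (x / x₀) ^ p) (a * p / x₀ * (x / x₀) ^ (p - 1)) x := by
  have h := (((hasDerivAt_id' x).div_const x₀).rpow_const (p := p)
    (Or.inl (div_ne_zero hx hx₀))).const_mul a
  exact h.congr_deriv (by ring)

theorem deriv_const_mul_div_rpow_self (a p : ℝ) {x₀ : ℝ} (hx₀ : x₀ ≠ 0) :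
    deriv (fun x : ℝ => a * (x / x₀) ^ p) x₀ = a * p / x₀ := by
  simp [(hasDerivAt_const_mul_div_rpow a p hx₀ hx₀).deriv, hx₀]

theorem deriv_deriv_const_mul_div_rpow_self (a p : ℝ) {x₀ : ℝ} (hx₀ : x₀ ≠ 0) :
    deriv (deriv (fun x : ℝ => a * (x / x₀) ^ p)) x₀ = a * p * (p - 1) / x₀ ^ 2 := by
  have h : deriv (fun x : ℝ => a * (x / x₀) ^ p) =ᶠ[nhds x₀]
      fun x => a * p / x₀ * (x / x₀) ^ (p - 1) := by
    filter_upwards [isOpen_ne.mem_nhds hx₀] with x hx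
    exact (hasDerivAt_const_mul_div_rpow a p hx hx₀).deriv
  rw [h.deriv_eq, deriv_const_mul_div_rpow_self _ _ hx₀]
  ring

/-- If `c₁ > c₂ > 0`, then at the state `(x₀, y₀)` the curve with constant `c₁`
has both a larger instantaneous price `|f'(x₀)|` and a larger slippage `f''(x₀)`
than the curve with constant `c₂`; these values are `cᵢ * y₀ / x₀` and
`cᵢ * (cᵢ + 1) * y₀ / x₀²` respectively. -/
theorem price_and_slippage_increasing (c₁ c₂ x₀ y₀ : ℝ)
    (hc₂ : 0 < c₂) (hc : c₂ < c₁) (hx₀ : 0 < x₀) (hy₀ : 0 < y₀) :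
    |deriv (fun x : ℝ => y₀ * (x / x₀) ^ (-c₁)) x₀| >
      |deriv (fun x : ℝ => y₀ * (x / x₀) ^ (-c₂)) x₀| ∧
    deriv (deriv (fun x : ℝ => y₀ * (x / x₀) ^ (-c₁))) x₀ >
      deriv (deriv (fun x : ℝ => y₀ * (x / x₀) ^ (-c₂))) x₀ ∧
    |deriv (fun x : ℝ => y₀ * (x / x₀) ^ (-c₁)) x₀| = c₁ * y₀ / x₀ ∧
    |deriv (fun x : ℝ => y₀ * (x / x₀) ^ (-c₂)) x₀| = c₂ * y₀ / x₀ ∧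
    deriv (deriv (fun x : ℝ => y₀ * (x / x₀) ^ (-c₁))) x₀ = c₁ * (c₁ + 1) * y₀ / x₀ ^ 2 ∧
    deriv (deriv (fun x : ℝ => y₀ * (x / x₀) ^ (-c₂))) x₀ = c₂ * (c₂ + 1) * y₀ / x₀ ^ 2 := by
  have price (c : ℝ) (hc : 0 < c) :
      |deriv (fun x : ℝ => y₀ * (x / x₀) ^ (-c)) x₀| = c * y₀ / x₀ := by
    rw [deriv_const_mul_div_rpow_self _ _ hx₀.ne', mul_neg, neg_div, abs_neg, mul_comm,
      abs_of_pos (by positivity)]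
  have slippage (c : ℝ) :
      deriv (deriv (fun x : ℝ => y₀ * (x / x₀) ^ (-c))) x₀ = c * (c + 1) * y₀ / x₀ ^ 2 := by
    rw [deriv_deriv_const_mul_div_rpow_self _ _ hx₀.ne']
    ring
  have hc₁ : 0 < c₁ := hc₂.trans hc
  rw [price c₁ hc₁, price c₂ hc₂, slippage c₁, slippage c₂]
  refine ⟨?_, ?_, rfl, rfl, rfl, rfl⟩ <;> gcongr
end

section
/- Let G be a simple graph on a finite vertex set V and let w assign a nonnegative real weight to each edge of G. Let M be a matching in G (a set of pairwise vertex-disjoint edges of G) with the following domination property: for every edge e of G, there exists an edge e' ∈ M that shares at least one vertex with e (possibly e' = e) and satisfies w(e') ≥ w(e). Then for every matching M* of G, ∑_{e∈M*} w(e) ≤ 2·∑_{e∈M} w(e). In particular, if a maximum weight matching of G has total weight W, then the total weight of M is at least W/2. -/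
/-- A family of pairwise vertex-disjoint edges all meeting a fixed edge `e` has at most two
members. -/
theorem Sym2.card_le_two_of_disjoint_of_forall_meets {V : Type*} [DecidableEq V]
    (S : Finset (Sym2 V))
    (hS : ∀ e ∈ S, ∀ f ∈ S, e ≠ f → ∀ v : V, v ∈ e → v ∉ f)
    (e : Sym2 V) (hmeet : ∀ f ∈ S, ∃ v : V, v ∈ f ∧ v ∈ e) : S.card ≤ 2 := by
  have : Nonempty V := ⟨e.out.1⟩
  choose! v hvf hve using hmeet
  calc S.card ≤ e.toFinset.card := by
        refine Finset.card_le_card_of_injOn v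
          (fun f hf => Sym2.mem_toFinset.2 (hve f hf)) fun f hf f' hf' h => ?_
        by_contra hne
        exact hS f hf f' hf' hne (v f) (hvf f hf) (h ▸ hvf f' hf')
    _ ≤ 2 := by
        rw [Sym2.card_toFinset]
        split_ifs <;> norm_num

open Finset in
/-- Greedy matching half-approximation invariant: if `M` is a matching in a
finite simple graph `G` with nonnegative edge weights `w` such that every edge
of `G` shares a vertex with some edge of `M` of at least its weight, then every
matching `M*` of `G` has total weight at most twice that of `M`. -/
theorem matching_domination_half_approx {V : Type*} [Fintype V] [DecidableEq V]
    (G : SimpleGraph V) [DecidableRel G.Adj]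
    (w : Sym2 V → ℝ) (hw : ∀ e ∈ G.edgeSet, 0 ≤ w e)
    (M : Finset (Sym2 V))
    (hM_sub : ∀ e ∈ M, e ∈ G.edgeSet)
    (hM_match : ∀ e ∈ M, ∀ f ∈ M, e ≠ f → ∀ v : V, v ∈ e → v ∉ f)
    (hdom : ∀ e ∈ G.edgeSet, ∃ e' ∈ M, (∃ v : V, v ∈ e ∧ v ∈ e') ∧ w e ≤ w e')
    (Mstar : Finset (Sym2 V))
    (hMstar_sub : ∀ e ∈ Mstar, e ∈ G.edgeSet)
    (hMstar_match : ∀ e ∈ Mstar, ∀ f ∈ Mstar, e ≠ f → ∀ v : V, v ∈ e → v ∉ f) :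
    ∑ e ∈ Mstar, w e ≤ 2 * ∑ e ∈ M, w e := by
  have hdom' : ∀ e ∈ Mstar, ∃ e' ∈ M, (∃ v : V, v ∈ e ∧ v ∈ e') ∧ w e ≤ w e' :=
    fun e he => hdom e (hMstar_sub e he)
  choose! g hgM hmeet hle using hdom'
  calc ∑ e ∈ Mstar, w e ≤ ∑ e ∈ Mstar, w (g e) := Finset.sum_le_sum hle
    _ = ∑ e' ∈ M, ((Mstar.filter (g · = e')).card : ℝ) * w e' := by
        rw [← Finset.sum_fiberwise_of_maps_to' hgM w]
        simp only [Finset.sum_const, nsmul_eq_mul]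
    _ ≤ ∑ e' ∈ M, 2 * w e' := by
        refine Finset.sum_le_sum fun e' he' =>
          mul_le_mul_of_nonneg_right ?_ (hw e' (hM_sub e' he'))
        exact_mod_cast Sym2.card_le_two_of_disjoint_of_forall_meets _
          (fun e he f hf => hMstar_match e (Finset.mem_filter.1 he).1 f (Finset.mem_filter.1 hf).1)
          e' fun f hf => by
            obtain ⟨hfM, rfl⟩ := Finset.mem_filter.1 hf
            exact hmeet f hfM
    _ = 2 * ∑ e ∈ M, w e := (Finset.mul_sum ..).symm
end
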